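/- Let S be an S-tree with at least two vertices. Then the matching number of S equals the cardinality of its core: ν(S) = |Core(S)|. -/

import Mathlib

open scoped Classical

namespace NullDecomp

variable {V : Type*}

/-- The null space of the real adjacency matrix of a graph. -/
def nullSpace [Fintype V] (G : SimpleGraph V) : Set (V → ℝ) :=
  {x | Matrix.mulVec (G.adjMatrix ℝ) x = 0}

/-- The support of the null space: vertices with a nonzero entry in some null vector. -/
def supportSet [Fintype V] (G : SimpleGraph V) : Set V :=
  {v | ∃ x ∈ nullSpace G, x v ≠ 0}

/-- The (open) neighborhood of a set of vertices. -/
def nbhdSet (G : SimpleGraph V) (A : Set V) : Set V :=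
  {v | ∃ u ∈ A, G.Adj u v}

/-- The closed neighborhood of a set of vertices. -/
def closedNbhd (G : SimpleGraph V) (A : Set V) : Set V :=
  A ∪ nbhdSet G A

/-- The core of a graph: the neighborhood of the support of the null space. -/
def coreSet [Fintype V] (G : SimpleGraph V) : Set V :=
  nbhdSet G (supportSet G)

/-- A tree is an S-tree if the closed neighborhood of its support is everything. -/
def IsSTree [Fintype V] (G : SimpleGraph V) : Prop :=
  G.IsTree ∧ closedNbhd G (supportSet G) = Set.univ

/-- A matching: a set of edges of `G`, pairwise disjoint. -/
def IsMatchingSet (G : SimpleGraph V) (M : Finset (Sym2 V)) : Prop :=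
  (↑M : Set (Sym2 V)) ⊆ G.edgeSet ∧
    ∀ e ∈ M, ∀ f ∈ M, e ≠ f → ∀ v : V, v ∈ e → v ∉ f

/-- A maximum matching. -/
def IsMaxMatching [Fintype V] (G : SimpleGraph V) (M : Finset (Sym2 V)) : Prop :=
  IsMatchingSet G M ∧ ∀ M' : Finset (Sym2 V), IsMatchingSet G M' → M'.card ≤ M.card

/-- The matching number. -/
noncomputable def matchingNumber [Fintype V] (G : SimpleGraph V) : ℕ :=
  sSup {n | ∃ M : Finset (Sym2 V), IsMatchingSet G M ∧ M.card = n}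

/-- An independent set of vertices. -/
def IsIndep (G : SimpleGraph V) (A : Set V) : Prop :=
  ∀ u ∈ A, ∀ w ∈ A, ¬ G.Adj u w

/-- The independence number. -/
noncomputable def indepNumber [Fintype V] (G : SimpleGraph V) : ℕ :=
  sSup {n | ∃ A : Set V, IsIndep G A ∧ A.ncard = n}

/-- A vertex cover. -/
def IsVertexCover (G : SimpleGraph V) (Cs : Set V) : Prop :=
  ∀ e ∈ G.edgeSet, ∃ v ∈ Cs, v ∈ e

/-- The vertex cover number. -/
noncomputable def coverNumber [Fintype V] (G : SimpleGraph V) : ℕ :=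
  sInf {n | ∃ Cs : Set V, IsVertexCover G Cs ∧ Cs.ncard = n}

/-- The nullity of a graph: dimension of the kernel of its adjacency matrix. -/
noncomputable def nullity [Fintype V] (G : SimpleGraph V) : ℕ :=
  Module.finrank ℝ (LinearMap.ker (Matrix.mulVecLin (G.adjMatrix ℝ)))

/-- The number of maximum matchings of a graph. -/
noncomputable def numMaxMatchings [Fintype V] (G : SimpleGraph V) : ℕ :=
  Set.ncard {M : Finset (Sym2 V) | IsMaxMatching G M}

/-- `C` is (the vertex set of) a connected component of the subgraph of `T`
induced by the closed neighborhood of the support of `T`. -/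
def IsSComponent [Fintype V] (T : SimpleGraph V) (C : Set V) : Prop :=
  ∃ c : (T.induce (closedNbhd T (supportSet T))).ConnectedComponent,
    C = Subtype.val '' c.supp

/-- `C` is (the vertex set of) a connected component of the subgraph of `T`
induced by the complement of the closed neighborhood of the support of `T`. -/
def IsNComponent [Fintype V] (T : SimpleGraph V) (C : Set V) : Prop :=
  ∃ c : (T.induce ((closedNbhd T (supportSet T))ᶜ)).ConnectedComponent,
    C = Subtype.val '' c.supp

/-- The zero-extension to `ℝ^V` of the null space of the subgraph of `T` induced by `C`:
vectors vanishing outside `C` whose restriction to `C` is a null vector of `T.induce C`. -/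
noncomputable def extNull [Fintype V] (T : SimpleGraph V) (C : Set V) : Submodule ℝ (V → ℝ) :=
  LinearMap.ker ((Matrix.mulVecLin ((T.induce C).adjMatrix ℝ)).comp
      (LinearMap.funLeft ℝ ℝ (Subtype.val : ↥C → V))) ⊓
  LinearMap.ker (LinearMap.funLeft ℝ ℝ (Subtype.val : ↥(Cᶜ) → V))

lemma mem_nullSpace_iff [Fintype V] {G : SimpleGraph V} {x : V → ℝ} :
    x ∈ nullSpace G ↔ ∀ v, ∑ w, (if G.Adj v w then x w else 0) = 0 := by
  simp [nullSpace, funext_iff, Matrix.mulVec, dotProduct, SimpleGraph.adjMatrix_apply]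

/-- Across a bridge, the entries of any two null vectors are proportional. -/
lemma mul_eq_mul_of_isBridge [Fintype V] {G : SimpleGraph V} {u v : V} (huv : G.Adj u v)
    (hb : G.IsBridge s(u, v)) {x y : V → ℝ} (hx : x ∈ nullSpace G) (hy : y ∈ nullSpace G) :
    x u * y v = y u * x v := by
  rw [SimpleGraph.isBridge_iff] at hb
  rw [mem_nullSpace_iff] at hx hy
  set H := G.deleteEdges {s(u, v)} with hH
  let B : Finset V := Finset.univ.filter fun w => H.Reachable u w
  let g : V → V → ℝ := fun a b => if G.Adj a b then x a * y b - y a * x b else 0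
  have hu : u ∈ B := by simp [B]
  have hv : v ∈ Bᶜ := by simpa [B] using hb
  have hcross : ∀ a ∈ B, ∀ b ∈ Bᶜ, G.Adj a b → a = u ∧ b = v := by
    intro a ha b hb' hab
    simp only [B, Finset.mem_compl, Finset.mem_filter, Finset.mem_univ, true_and] at ha hb'
    by_cases he : s(a, b) = s(u, v)
    · rcases Sym2.eq_iff.1 he with h | ⟨rfl, rfl⟩
      · exact h
      · exact absurd ha hb
    · have : H.Adj a b := by simp [hH, SimpleGraph.deleteEdges_adj, hab, he]
      exact absurd (ha.trans this.reachable) hb'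
  have hrow : ∀ a, ∑ b, g a b = 0 := by
    intro a
    have : ∀ b, g a b = x a * (if G.Adj a b then y b else 0) -
        y a * (if G.Adj a b then x b else 0) := by
      intro b
      by_cases h : G.Adj a b <;> simp [g, h]
    simp_rw [this, Finset.sum_sub_distrib, ← Finset.mul_sum, hx a, hy a]
    simp
  have hin : ∑ a ∈ B, ∑ b ∈ B, g a b = 0 := by
    have hanti : ∀ a b, g a b = - g b a := by
      intro a b
      by_cases h : G.Adj a b
      · simp only [g, h, h.symm, if_true]
        ring
      · have h' : ¬ G.Adj b a := fun h' => h h'.symm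
        simp [g, h, h']
    have h1 : ∑ a ∈ B, ∑ b ∈ B, g a b = - ∑ a ∈ B, ∑ b ∈ B, g a b := by
      conv_lhs => rw [Finset.sum_comm]
      simp_rw [← Finset.sum_neg_distrib]
      exact Finset.sum_congr rfl fun b _ => Finset.sum_congr rfl fun a _ => hanti a b
    linarith
  have hout : ∑ a ∈ B, ∑ b ∈ Bᶜ, g a b = g u v := by
    rw [Finset.sum_eq_single_of_mem u hu, Finset.sum_eq_single_of_mem v hv]
    · intro b hb' hne
      exact if_neg fun h => hne (hcross u hu b hb' h).2
    · intro a ha hne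
      exact Finset.sum_eq_zero fun b hb' => if_neg fun h => hne (hcross a ha b hb' h).1
  have htot : ∑ a ∈ B, ∑ b ∈ B, g a b + ∑ a ∈ B, ∑ b ∈ Bᶜ, g a b = 0 := by
    rw [← Finset.sum_add_distrib]
    exact Finset.sum_eq_zero fun a _ => by rw [Finset.sum_add_sum_compl, hrow]
  rw [hin, hout, zero_add] at htot
  simp only [g, huv, if_true] at htot
  linarith

/-- The support of an acyclic graph is independent. -/
lemma not_adj_of_mem_supportSet [Fintype V] {G : SimpleGraph V} (hG : G.IsAcyclic) {u v : V}
    (hu : u ∈ supportSet G) (hv : v ∈ supportSet G) : ¬ G.Adj u v := by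
  intro huv
  have hb : G.IsBridge s(u, v) := SimpleGraph.isAcyclic_iff_forall_adj_isBridge.1 hG huv
  obtain ⟨c⟩ := hG.colorable_two
  let s : V → ℝ := fun w => if c w = 0 then 1 else -1
  have hs : ∀ a b, G.Adj a b → s b = - s a := by
    intro a b hab
    have := c.valid hab
    by_cases ha : c a = 0 <;> by_cases hb : c b = 0 <;> simp [s, ha, hb] <;> omega
  have hs0 : s u ≠ 0 := by
    by_cases h : c u = 0 <;> simp [s, h]
  have hprod : ∀ x ∈ nullSpace G, x u * x v = 0 := by
    intro x hx
    have hsx : (fun w => s w * x w) ∈ nullSpace G := by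
      rw [mem_nullSpace_iff] at hx ⊢
      intro a
      have : ∀ b, (if G.Adj a b then s b * x b else 0) =
          - s a * (if G.Adj a b then x b else 0) := by
        intro b
        by_cases h : G.Adj a b
        · simp [h, hs a b h]
        · simp [h]
      simp_rw [this, ← Finset.mul_sum, hx a, mul_zero]
    have h := mul_eq_mul_of_isBridge huv hb hx hsx
    simp only [hs u v huv] at h
    have h' : s u * (x u * x v) = 0 := by linarith
    exact (mul_eq_zero.1 h').resolve_left hs0
  obtain ⟨x, hx, hxu⟩ := hu
  obtain ⟨y, hy, hyv⟩ := hv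
  have hxv := (mul_eq_zero.1 (hprod x hx)).resolve_left hxu
  have h := mul_eq_mul_of_isBridge huv hb hx hy
  rw [hxv, mul_zero] at h
  exact mul_ne_zero hxu hyv h

/-- A vertex adjacent to the support has at least two neighbors in the support. -/
lemma exists_ne_adj_mem_supportSet [Fintype V] {G : SimpleGraph V} {u v : V}
    (hu : u ∈ supportSet G) (huv : G.Adj u v) :
    ∃ w ∈ supportSet G, w ≠ u ∧ G.Adj w v := by
  obtain ⟨x, hx, hxu⟩ := hu
  by_contra! h
  have hv := mem_nullSpace_iff.1 hx v
  rw [Finset.sum_eq_single_of_mem u (Finset.mem_univ u), if_pos huv.symm] at hv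
  · exact hxu hv
  · intro w _ hwu
    split_ifs with hvw
    · by_contra hxw
      exact h w ⟨x, hx, hxw⟩ hwu hvw.symm
    · rfl

/-- In a tree there is a parent function such that one endpoint of each edge is the parent of
the other. -/
lemma exists_parent {G : SimpleGraph V} (hG : G.IsTree) :
    ∃ par : V → V, ∀ u v, G.Adj u v → par u = v ∨ par v = u := by
  obtain ⟨r⟩ := hG.connected.nonempty
  choose p hp hp' using (hG.existsUnique_path · r)
  refine ⟨fun v => (p v).snd, fun u v huv => ?_⟩
  by_cases h : v ∈ (p u).support
  · exact Or.inl (hG.isAcyclic.eq_snd_of_adj_start (hp u) huv h).symm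
  · right
    have : SimpleGraph.Walk.cons huv.symm (p u) = p v :=
      hp' v _ ((SimpleGraph.Walk.cons_isPath_iff _ _).2 ⟨hp u, h⟩)
    simp [← this]

lemma card_le_ncard_of_isVertexCover [Finite V] {G : SimpleGraph V} {C : Set V}
    (hC : IsVertexCover G C) {M : Finset (Sym2 V)} (hM : IsMatchingSet G M) :
    M.card ≤ C.ncard := by
  have hC' : ∀ e : Sym2 V, ∃ v, e ∈ G.edgeSet → v ∈ C ∧ v ∈ e := by
    intro e
    by_cases he : e ∈ G.edgeSet
    · obtain ⟨v, hv⟩ := hC e he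
      exact ⟨v, fun _ => hv⟩
    · exact ⟨e.out.1, fun h => absurd h he⟩
  choose f hf using hC'
  rw [← Set.ncard_coe_finset]
  refine Set.ncard_le_ncard_of_injOn f (fun e he => (hf e (hM.1 he)).1) ?_ (Set.toFinite _)
  intro e he e' he' h
  by_contra hne
  exact hM.2 e he e' he' hne (f e) (hf e (hM.1 he)).2 (h ▸ (hf e' (hM.1 he')).2)

lemma exists_isMatchingSet_card_eq [Finite V] {G : SimpleGraph V} {C : Set V} {f : V → V}
    (hadj : ∀ v ∈ C, G.Adj v (f v)) (hf : ∀ v ∈ C, f v ∉ C) (hinj : Set.InjOn f C) :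
    ∃ M : Finset (Sym2 V), IsMatchingSet G M ∧ M.card = C.ncard := by
  have hmeet : ∀ v ∈ C, ∀ w ∈ C, ∀ z, z ∈ s(v, f v) → z ∈ s(w, f w) → v = w := by
    intro v hv w hw z hz hz'
    rw [Sym2.mem_iff] at hz hz'
    rcases hz with rfl | rfl <;> rcases hz' with h | h
    · exact h
    · exact absurd (h ▸ hv) (hf w hw)
    · exact absurd (h.symm ▸ hw) (hf v hv)
    · exact hinj hv hw h
  have hfin := Set.toFinite C
  refine ⟨hfin.toFinset.image fun v => s(v, f v), ⟨?_, ?_⟩, ?_⟩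
  · intro e he
    simp only [Finset.coe_image, Set.Finite.coe_toFinset, Set.mem_image] at he
    obtain ⟨v, hv, rfl⟩ := he
    exact hadj v hv
  · intro e he e' he' hne z hz hz'
    simp only [Finset.mem_image, Set.Finite.mem_toFinset] at he he'
    obtain ⟨v, hv, rfl⟩ := he
    obtain ⟨w, hw, rfl⟩ := he'
    exact hne (by rw [hmeet v hv w hw z hz hz'])
  · rw [Finset.card_image_of_injOn, Set.ncard_eq_toFinset_card C hfin]
    intro v hv w hw (h : s(v, f v) = s(w, f w))
    simp only [Set.Finite.coe_toFinset] at hv hw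
    exact hmeet v hv w hw v (Sym2.mem_mk_left _ _) (h ▸ Sym2.mem_mk_left v (f v))

lemma isVertexCover_coreSet [Fintype V] {G : SimpleGraph V}
    (hG : closedNbhd G (supportSet G) = Set.univ) : IsVertexCover G (coreSet G) := by
  intro e
  induction e with
  | _ u v =>
    intro huv
    have hu : u ∈ closedNbhd G (supportSet G) := hG ▸ Set.mem_univ u
    rcases hu with hu | hu
    · exact ⟨v, ⟨u, hu, huv⟩, Sym2.mem_mk_right u v⟩
    · exact ⟨u, hu, Sym2.mem_mk_left u v⟩

/-- In a tree, some matching saturates the core with edges to the support. -/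
lemma exists_isMatchingSet_card_eq_ncard_coreSet [Fintype V] {G : SimpleGraph V}
    (hG : G.IsTree) : ∃ M : Finset (Sym2 V), IsMatchingSet G M ∧ M.card = (coreSet G).ncard := by
  obtain ⟨par, hpar⟩ := exists_parent hG
  have hchild : ∀ v ∈ coreSet G, ∃ w ∈ supportSet G, G.Adj w v ∧ par w = v := by
    rintro v ⟨u, hu, huv⟩
    obtain ⟨w, hw, hwu, hwv⟩ := exists_ne_adj_mem_supportSet hu huv
    rcases hpar u v huv with h | h
    · exact ⟨u, hu, huv, h⟩
    · exact ⟨w, hw, hwv, (hpar w v hwv).resolve_right fun h' => hwu (h'.symm.trans h)⟩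
  choose! f hfsupp hadj hpf using hchild
  refine exists_isMatchingSet_card_eq (fun v hv => (hadj v hv).symm) ?_ ?_
  · rintro v hv ⟨u, hu, huf⟩
    exact not_adj_of_mem_supportSet hG.isAcyclic hu (hfsupp v hv) huf
  · intro v hv w hw h
    rw [← hpf v hv, ← hpf w hw, h]

/-- For an S-tree with at least two vertices, the matching number equals
the cardinality of the core. -/
theorem stmt7 [Fintype V] (S : SimpleGraph V) (hS : IsSTree S)
    (h2 : 2 ≤ Fintype.card V) :
    matchingNumber S = (coreSet S).ncard := by
  refine IsGreatest.csSup_eq ⟨exists_isMatchingSet_card_eq_ncard_coreSet hS.1, ?_⟩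
  rintro n ⟨M, hM, rfl⟩
  exact card_le_ncard_of_isVertexCover (isVertexCover_coreSet hS.2) hM

end NullDecomp
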